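/- arXiv:2306.04976 — 6 statements merged into one kernel-verified Lean document; each statement's English description precedes it below -/
import Mathlib

section
/- Let τ ∈ ℝ with τ ≠ 2, τ ≠ −2 and τ ≠ 0, and let ν = (ν₁,ν₂) ∈ ℝ² with ν₁² + ν₂² = 1. Then for all vectors v₊, v₋ ∈ ℂ² the following equivalence of transmission conditions holds: v₋ = M(ν,τ)·v₊ if and only if −i·(σ·ν)·(v₊ − v₋) = (τ/2)·σ₃·(v₊ + v₋). -/
open Matrix

noncomputable section

/-- The Pauli matrix `σ₁`. -/
def σ1 : Matrix (Fin 2) (Fin 2) ℂ := !![0, 1; 1, 0]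

/-- The Pauli matrix `σ₂`. -/
def σ2 : Matrix (Fin 2) (Fin 2) ℂ := !![0, -Complex.I; Complex.I, 0]

/-- The Pauli matrix `σ₃`. -/
def σ3 : Matrix (Fin 2) (Fin 2) ℂ := !![1, 0; 0, -1]

/-- `σ·ν = ν₁σ₁ + ν₂σ₂` for `ν ∈ ℝ²`. -/
def sigmaDot (ν : ℝ × ℝ) : Matrix (Fin 2) (Fin 2) ℂ :=
  ((ν.1 : ℂ)) • σ1 + ((ν.2 : ℂ)) • σ2

/-- The transmission matrix `M(ν,τ) = ((4+τ²)/(4−τ²))·σ₀ + (4τ/(4−τ²))·i·σ₃·(σ·ν)`. -/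
def Mmat (ν : ℝ × ℝ) (τ : ℝ) : Matrix (Fin 2) (Fin 2) ℂ :=
  (((4 + τ ^ 2) / (4 - τ ^ 2) : ℝ) : ℂ) • (1 : Matrix (Fin 2) (Fin 2) ℂ)
    + (((4 * τ) / (4 - τ ^ 2) : ℝ) : ℂ) • (Complex.I • (σ3 * sigmaDot ν))

/-- The candidate inverse `((4+τ²)/(4−τ²))·σ₀ − (4τ/(4−τ²))·i·σ₃·(σ·ν)`. -/
def MmatInv (ν : ℝ × ℝ) (τ : ℝ) : Matrix (Fin 2) (Fin 2) ℂ :=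
  (((4 + τ ^ 2) / (4 - τ ^ 2) : ℝ) : ℂ) • (1 : Matrix (Fin 2) (Fin 2) ℂ)
    - (((4 * τ) / (4 - τ ^ 2) : ℝ) : ℂ) • (Complex.I • (σ3 * sigmaDot ν))

/-- Componentwise form of the equivalence: `s` and `s'` are the off-diagonal entries of `σ·ν`. -/
theorem transmission_components_iff {t s s' p₀ p₁ m₀ m₁ : ℂ} (ht : 4 - t ^ 2 ≠ 0)
    (hs : s * s' = 1) :
    (m₀ = (4 + t ^ 2) / (4 - t ^ 2) * p₀ + 4 * t / (4 - t ^ 2) * (Complex.I * s) * p₁ ∧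
      m₁ = -(4 * t / (4 - t ^ 2) * (Complex.I * s') * p₀) +
        (4 + t ^ 2) / (4 - t ^ 2) * p₁) ↔
    (-Complex.I * (s * (p₁ - m₁)) = t / 2 * (p₀ + m₀) ∧
      -Complex.I * (s' * (p₀ - m₀)) = -(t / 2 * (p₁ + m₁))) := by
  have hI : Complex.I ^ 2 = -1 := Complex.I_sq
  have hIs : Complex.I ^ 2 * (s * s') = -1 := by rw [hI, hs, mul_one]
  have h₀ : (m₀ = (4 + t ^ 2) / (4 - t ^ 2) * p₀ + 4 * t / (4 - t ^ 2) * (Complex.I * s) * p₁) ↔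
      (4 - t ^ 2) * m₀ = (4 + t ^ 2) * p₀ + 4 * t * Complex.I * s * p₁ := by
    rw [← mul_right_inj' ht]
    field_simp
  have h₁ : (m₁ = -(4 * t / (4 - t ^ 2) * (Complex.I * s') * p₀) +
        (4 + t ^ 2) / (4 - t ^ 2) * p₁) ↔
      (4 - t ^ 2) * m₁ = -(4 * t * Complex.I * s' * p₀) + (4 + t ^ 2) * p₁ := by
    rw [← mul_right_inj' ht]
    field_simp
  rw [h₀, h₁]
  constructor
  · rintro ⟨c₀, c₁⟩
    constructor <;> apply mul_left_cancel₀ ht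
    · linear_combination (-t / 2) * c₀ + Complex.I * s * c₁ - 4 * t * p₀ * hIs
    · linear_combination Complex.I * s' * c₀ + t / 2 * c₁ + 4 * t * p₁ * hIs
  · rintro ⟨e₀, e₁⟩
    constructor
    · linear_combination 2 * t * e₀ - 4 * Complex.I * s * e₁ + 4 * (m₀ - p₀) * hIs
    · linear_combination -4 * Complex.I * s' * e₀ - 2 * t * e₁ + 4 * (m₁ - p₁) * hIs

/-- Equivalence of the two forms of the transmission condition: `v₋ = M(ν,τ)·v₊` iff
`−i·(σ·ν)·(v₊ − v₋) = (τ/2)·σ₃·(v₊ + v₋)`. -/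
theorem transmission_condition_equiv (τ : ℝ) (hτ : τ ≠ 2) (hτ' : τ ≠ -2) (hτ0 : τ ≠ 0)
    (ν : ℝ × ℝ) (hν : ν.1 ^ 2 + ν.2 ^ 2 = 1) (vp vm : Fin 2 → ℂ) :
    vm = (Mmat ν τ).mulVec vp ↔
      (-Complex.I) • (sigmaDot ν).mulVec (vp - vm)
        = ((τ / 2 : ℝ) : ℂ) • σ3.mulVec (vp + vm) := by
  have ht : (4 - (τ : ℂ) ^ 2) ≠ 0 := by
    have h : (4 - τ ^ 2 : ℝ) ≠ 0 := by
      have := mul_ne_zero (sub_ne_zero.2 hτ) (sub_ne_zero.2 hτ')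
      contrapose! this
      linear_combination -this
    exact_mod_cast h
  have hs : ((ν.1 : ℂ) - ν.2 * Complex.I) * (ν.1 + ν.2 * Complex.I) = 1 := by
    have h : (ν.1 : ℂ) ^ 2 + (ν.2 : ℂ) ^ 2 = 1 := by exact_mod_cast hν
    linear_combination h - (ν.2 : ℂ) ^ 2 * Complex.I_sq
  convert transmission_components_iff (p₀ := vp 0) (p₁ := vp 1) (m₀ := vm 0) (m₁ := vm 1)
    ht hs using 1 <;>
  · simp [-neg_inj, funext_iff, Fin.forall_fin_two, Mmat, sigmaDot, σ1, σ2, σ3, dotProduct,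
      Fin.sum_univ_two]
    ring_nf

end
end

section
/- Let τ ∈ ℝ with τ ≠ 2 and τ ≠ −2, let ν = (ν₁,ν₂) ∈ ℝ² with ν₁² + ν₂² = 1, and set Θ := (1/√2)·(σ₀ + i·(σ·ν)). Then Θ is unitary, i.e. Θ*·Θ = σ₀ where Θ* denotes the conjugate transpose, and Θ* · M(ν,τ) · Θ = ((4+τ²)/(4−τ²))·σ₀ − (4τ/(4−τ²))·σ₃. -/
open Matrix

noncomputable section

theorem conjTranspose_sigmaDot (ν : ℝ × ℝ) : (sigmaDot ν)ᴴ = sigmaDot ν := by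
  ext i j
  fin_cases i <;> fin_cases j <;> simp [sigmaDot, σ1, σ2]

theorem sigmaDot_mul_self (ν : ℝ × ℝ) (hν : ν.1 ^ 2 + ν.2 ^ 2 = 1) :
    sigmaDot ν * sigmaDot ν = 1 := by
  have h : (ν.1 : ℂ) ^ 2 + (ν.2 : ℂ) ^ 2 = 1 := by exact_mod_cast hν
  ext i j
  fin_cases i <;> fin_cases j <;> simp [sigmaDot, σ1, σ2, Matrix.mul_apply] <;>
    linear_combination h - (ν.2 : ℂ) ^ 2 * Complex.I_sq

theorem sigmaDot_mul_σ3 (ν : ℝ × ℝ) : sigmaDot ν * σ3 = -(σ3 * sigmaDot ν) := by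
  ext i j
  fin_cases i <;> fin_cases j <;> simp [sigmaDot, σ1, σ2, σ3, Matrix.mul_apply]

theorem conjTranspose_one_add_I_smul_sigmaDot (c : ℝ) (ν : ℝ × ℝ) :
    ((c : ℂ) • ((1 : Matrix (Fin 2) (Fin 2) ℂ) + Complex.I • sigmaDot ν))ᴴ
      = (c : ℂ) • (1 - Complex.I • sigmaDot ν) := by
  simp [conjTranspose_smul, conjTranspose_sigmaDot, sub_eq_add_neg]

theorem one_sub_mul_one_add_I_smul_sigmaDot (ν : ℝ × ℝ) (hν : ν.1 ^ 2 + ν.2 ^ 2 = 1) :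
    (1 - Complex.I • sigmaDot ν) * (1 + Complex.I • sigmaDot ν) = (2 : ℂ) • 1 := by
  simp only [sub_mul, mul_add, one_mul, mul_one, smul_mul_smul_comm, sigmaDot_mul_self ν hν,
    Complex.I_mul_I]
  module

theorem one_sub_mul_σ3_mul_sigmaDot_mul_one_add (ν : ℝ × ℝ) (hν : ν.1 ^ 2 + ν.2 ^ 2 = 1) :
    (1 - Complex.I • sigmaDot ν) * (Complex.I • (σ3 * sigmaDot ν)) * (1 + Complex.I • sigmaDot ν)
      = (-2 : ℂ) • σ3 := by
  have h : sigmaDot ν * (σ3 * sigmaDot ν) = -σ3 := by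
    rw [← mul_assoc, sigmaDot_mul_σ3, neg_mul, mul_assoc, sigmaDot_mul_self ν hν, mul_one]
  have h' : (σ3 * sigmaDot ν) * sigmaDot ν = σ3 := by
    rw [mul_assoc, sigmaDot_mul_self ν hν, mul_one]
  simp only [sub_mul, mul_add, one_mul, mul_one, smul_mul_assoc, mul_smul_comm, h, h', neg_mul,
    smul_neg, smul_sub, smul_smul, Complex.I_mul_I]
  module

/-- `Θ := (1/√2)·(σ₀ + i·(σ·ν))` is unitary and diagonalizes the transmission matrix:
`Θ*·M(ν,τ)·Θ = ((4+τ²)/(4−τ²))·σ₀ − (4τ/(4−τ²))·σ₃`. -/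
theorem Theta_unitary_and_diagonalizes (τ : ℝ) (hτ : τ ≠ 2) (hτ' : τ ≠ -2)
    (ν : ℝ × ℝ) (hν : ν.1 ^ 2 + ν.2 ^ 2 = 1) :
    (((1 / Real.sqrt 2 : ℝ) : ℂ) • ((1 : Matrix (Fin 2) (Fin 2) ℂ) + Complex.I • sigmaDot ν))ᴴ
        * (((1 / Real.sqrt 2 : ℝ) : ℂ) •
            ((1 : Matrix (Fin 2) (Fin 2) ℂ) + Complex.I • sigmaDot ν)) = 1 ∧
    (((1 / Real.sqrt 2 : ℝ) : ℂ) • ((1 : Matrix (Fin 2) (Fin 2) ℂ) + Complex.I • sigmaDot ν))ᴴ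
        * Mmat ν τ
        * (((1 / Real.sqrt 2 : ℝ) : ℂ) • ((1 : Matrix (Fin 2) (Fin 2) ℂ) + Complex.I • sigmaDot ν))
      = (((4 + τ ^ 2) / (4 - τ ^ 2) : ℝ) : ℂ) • (1 : Matrix (Fin 2) (Fin 2) ℂ)
          - (((4 * τ) / (4 - τ ^ 2) : ℝ) : ℂ) • σ3 := by
  have hc : ((1 / Real.sqrt 2 : ℝ) : ℂ) * ((1 / Real.sqrt 2 : ℝ) : ℂ) = 1 / 2 := by
    rw [← Complex.ofReal_mul, div_mul_div_comm, Real.mul_self_sqrt (by norm_num)]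
    norm_num
  rw [conjTranspose_one_add_I_smul_sigmaDot]
  constructor
  · rw [smul_mul_smul_comm, hc, one_sub_mul_one_add_I_smul_sigmaDot ν hν, smul_smul]
    norm_num
  · rw [smul_mul_assoc, smul_mul_smul_comm, hc, Mmat, mul_add (1 - _), add_mul, mul_smul_comm, mul_one,
      smul_mul_assoc, one_sub_mul_one_add_I_smul_sigmaDot ν hν, mul_smul_comm, smul_mul_assoc,
      one_sub_mul_σ3_mul_sigmaDot_mul_one_add ν hν]
    module

end
end

section
/- Let f, g : ℝ² → ℂ² be smooth functions with compact support and let Ω := {(x,y) ∈ ℝ² : y < 0} be the open lower half-plane. Then ∫_Ω ⟨(σ·∇)f, (σ·∇)g⟩ dx dy = ∫_Ω (⟨∂₁f, ∂₁g⟩ + ⟨∂₂f, ∂₂g⟩) dx dy − ∫_ℝ ⟨f(x,0), i·σ₃·(∂₁g)(x,0)⟩ dx, where the boundary ∂Ω = ℝ×{0} carries the outward unit normal ν = (0,1) and the corresponding tangential derivative is ∂₁. -/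
open Matrix MeasureTheory

noncomputable section

/-- First partial derivative of a `ℂ²`-valued function on `ℝ²`. -/
def pd1 (h : ℝ × ℝ → Fin 2 → ℂ) (p : ℝ × ℝ) : Fin 2 → ℂ := fderiv ℝ h p (1, 0)

/-- Second partial derivative of a `ℂ²`-valued function on `ℝ²`. -/
def pd2 (h : ℝ × ℝ → Fin 2 → ℂ) (p : ℝ × ℝ) : Fin 2 → ℂ := fderiv ℝ h p (0, 1)

/-- The inner product on `ℂ²`, linear in the first entry:
`⟨u,v⟩ = u₁·conj(v₁) + u₂·conj(v₂)`. -/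
def ip (u v : Fin 2 → ℂ) : ℂ :=
  u 0 * starRingEnd ℂ (v 0) + u 1 * starRingEnd ℂ (v 1)

/-- `(σ·∇)h = σ₁·∂₁h + σ₂·∂₂h`. -/
def sigmaGrad (h : ℝ × ℝ → Fin 2 → ℂ) (p : ℝ × ℝ) : Fin 2 → ℂ :=
  σ1.mulVec (pd1 h p) + σ2.mulVec (pd2 h p)

/-- The integral over the lower half-plane of the horizontal derivative of a compactly supported
`C¹` function vanishes. -/
theorem setIntegral_lowerHalfPlane_fderiv_fst {w : ℝ × ℝ → ℂ} (hw : ContDiff ℝ 1 w)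
    (hc : HasCompactSupport w) :
    ∫ p in {q : ℝ × ℝ | q.2 < 0}, fderiv ℝ w p (1, 0) = 0 := by
  have hwint : Integrable (fun p => fderiv ℝ w p (1, 0)) :=
    ((hw.continuous_fderiv one_ne_zero).clm_apply continuous_const).integrable_of_hasCompactSupport
      (hc.fderiv_apply (𝕜 := ℝ) _)
  have hs : {q : ℝ × ℝ | q.2 < 0} = Set.univ ×ˢ Set.Iio 0 := by ext; simp
  rw [hs, Measure.volume_eq_prod, ← setIntegral_prod_swap, setIntegral_prod]
  · rw [← integral_zero ℝ ℂ (μ := volume.restrict (Set.Iio 0))]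
    congr 1 with y
    have hline (x : ℝ) : HasDerivAt (fun t => w (t, y)) (fderiv ℝ w (x, y) (1, 0)) x :=
      ((hw.differentiable one_ne_zero).differentiableAt.hasFDerivAt).comp_hasDerivAt x
        ((hasDerivAt_id x).prodMk (hasDerivAt_const x y))
    have hemb : Topology.IsClosedEmbedding fun t : ℝ => (t, y) :=
      .of_continuous_injective_isClosedMap (by fun_prop) (fun a b h => by simpa using h)
        (isClosedMap_prodMk_right y)
    simp only [Prod.swap_prod_mk, Measure.restrict_univ]
    refine integral_eq_zero_of_hasDerivAt_of_integrable hline ?_ ?_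
    · exact (((hw.continuous_fderiv one_ne_zero).clm_apply
        continuous_const).comp hemb.continuous).integrable_of_hasCompactSupport
          ((hc.fderiv_apply (𝕜 := ℝ) _).comp_isClosedEmbedding hemb)
    · exact (hw.continuous.comp hemb.continuous).integrable_of_hasCompactSupport
        (hc.comp_isClosedEmbedding hemb)
  · exact hwint.swap.integrableOn

/-- The integral over the lower half-plane of the vertical derivative of a compactly supported
`C¹` function is the integral of its boundary values. -/
theorem setIntegral_lowerHalfPlane_fderiv_snd {w : ℝ × ℝ → ℂ} (hw : ContDiff ℝ 1 w)
    (hc : HasCompactSupport w) :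
    ∫ p in {q : ℝ × ℝ | q.2 < 0}, fderiv ℝ w p (0, 1) = ∫ x : ℝ, w (x, 0) := by
  have hwint : Integrable (fun p => fderiv ℝ w p (0, 1)) :=
    ((hw.continuous_fderiv one_ne_zero).clm_apply continuous_const).integrable_of_hasCompactSupport
      (hc.fderiv_apply (𝕜 := ℝ) _)
  have hs : {q : ℝ × ℝ | q.2 < 0} = Set.univ ×ˢ Set.Iio 0 := by ext; simp
  rw [hs, Measure.volume_eq_prod, setIntegral_prod _ hwint.integrableOn, Measure.restrict_univ]
  congr 1 with x
  have hline (y : ℝ) : HasDerivAt (fun t => w (x, t)) (fderiv ℝ w (x, y) (0, 1)) y :=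
    ((hw.differentiable one_ne_zero).differentiableAt.hasFDerivAt).comp_hasDerivAt y
      ((hasDerivAt_const y x).prodMk (hasDerivAt_id y))
  have hemb : Topology.IsClosedEmbedding fun t : ℝ => (x, t) :=
    .of_continuous_injective_isClosedMap (by fun_prop) (fun a b h => by simpa using h)
      (isClosedMap_prodMk_left x)
  rw [← integral_Iic_eq_integral_Iio]
  simp_rw [← (hline _).deriv]
  exact HasCompactSupport.integral_Iic_deriv_eq (by fun_prop) (hc.comp_isClosedEmbedding hemb) 0

/-- Integration by parts for the Jacobian determinant of `(b, a)` on the lower half-plane. -/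
theorem setIntegral_lowerHalfPlane_jacobian {a b : ℝ × ℝ → ℂ} (ha : ContDiff ℝ 1 a)
    (hb : ContDiff ℝ 2 b) (hac : HasCompactSupport a) :
    ∫ p in {q : ℝ × ℝ | q.2 < 0},
        (fderiv ℝ a p (0, 1) * fderiv ℝ b p (1, 0) - fderiv ℝ a p (1, 0) * fderiv ℝ b p (0, 1))
      = ∫ x : ℝ, a (x, 0) * fderiv ℝ b (x, 0) (1, 0) := by
  have hb' (v : ℝ × ℝ) : ContDiff ℝ 1 fun p => fderiv ℝ b p v :=
    (hb.fderiv_right (by norm_num)).clm_apply contDiff_const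
  have hw (v : ℝ × ℝ) : ContDiff ℝ 1 fun p => a p * fderiv ℝ b p v := ha.mul (hb' v)
  have hwc (v : ℝ × ℝ) : HasCompactSupport fun p => a p * fderiv ℝ b p v := hac.mul_right
  have hwint (u v : ℝ × ℝ) : Integrable fun p => fderiv ℝ (fun p => a p * fderiv ℝ b p v) p u :=
    (((hw v).continuous_fderiv one_ne_zero).clm_apply
      continuous_const).integrable_of_hasCompactSupport ((hwc v).fderiv_apply (𝕜 := ℝ) _)
  have hprod (p u v : ℝ × ℝ) : fderiv ℝ (fun p => a p * fderiv ℝ b p v) p u =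
      a p * fderiv ℝ (fderiv ℝ b) p u v + fderiv ℝ a p u * fderiv ℝ b p v := by
    have hd : DifferentiableAt ℝ (fderiv ℝ b) p :=
      ((hb.fderiv_right (m := 1) (by norm_num)).differentiable one_ne_zero).differentiableAt
    rw [fderiv_fun_mul (ha.differentiable one_ne_zero).differentiableAt
      ((hb' v).differentiable one_ne_zero).differentiableAt, fderiv_clm_apply hd (by fun_prop)]
    simp [mul_comm]
  have hsymm (p : ℝ × ℝ) : fderiv ℝ (fderiv ℝ b) p (0, 1) (1, 0) =
      fderiv ℝ (fderiv ℝ b) p (1, 0) (0, 1) :=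
    (hb.contDiffAt.isSymmSndFDerivAt (by simp)).eq _ _
  have hsub := integral_sub (hwint (0, 1) (1, 0)).integrableOn
    (hwint (1, 0) (0, 1)).integrableOn (μ := volume.restrict {q : ℝ × ℝ | q.2 < 0})
  rw [setIntegral_lowerHalfPlane_fderiv_snd (hw _) (hwc _),
    setIntegral_lowerHalfPlane_fderiv_fst (hw _) (hwc _), sub_zero] at hsub
  rw [← hsub]
  congr 1 with p
  rw [hprod, hprod, hsymm]
  ring

theorem fderiv_apply_pi {h : ℝ × ℝ → Fin 2 → ℂ} {p : ℝ × ℝ} (hh : DifferentiableAt ℝ h p)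
    (v : ℝ × ℝ) (j : Fin 2) : fderiv ℝ (fun q => h q j) p v = fderiv ℝ h p v j := by
  rw [fderiv_apply hh]
  rfl

/-- Integration by parts for the Dirac operator on the lower half-plane:
`∫_Ω ⟨(σ·∇)f, (σ·∇)g⟩ = ∫_Ω (⟨∂₁f,∂₁g⟩ + ⟨∂₂f,∂₂g⟩) − ∫_ℝ ⟨f(x,0), i·σ₃·(∂₁g)(x,0)⟩ dx`. -/
theorem sigmaGrad_integration_by_parts (f g : ℝ × ℝ → Fin 2 → ℂ)
    (hf : ContDiff ℝ (⊤ : ℕ∞) f) (hg : ContDiff ℝ (⊤ : ℕ∞) g)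
    (hfc : HasCompactSupport f) (hgc : HasCompactSupport g) :
    (∫ p in {q : ℝ × ℝ | q.2 < 0}, ip (sigmaGrad f p) (sigmaGrad g p))
      = (∫ p in {q : ℝ × ℝ | q.2 < 0},
          (ip (pd1 f p) (pd1 g p) + ip (pd2 f p) (pd2 g p)))
        - ∫ x : ℝ, ip (f (x, 0)) (Complex.I • σ3.mulVec (pd1 g (x, 0))) := by
  have hf1 : ContDiff ℝ 1 f := contDiff_infty.1 hf 1
  have hg2 : ContDiff ℝ 2 g := contDiff_infty.1 hg 2
  have hg1 : ContDiff ℝ 1 g := contDiff_infty.1 hg 1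
  have hfj (j : Fin 2) : ContDiff ℝ 1 fun p => f p j := contDiff_pi.1 hf1 j
  have hfjc (j : Fin 2) : HasCompactSupport fun p => f p j :=
    hfc.comp_left (g := fun u : Fin 2 → ℂ => u j) rfl
  have hgj (j : Fin 2) : ContDiff ℝ 2 fun p => starRingEnd ℂ (g p j) :=
    Complex.conjCLE.contDiff.comp (contDiff_pi.1 hg2 j)
  have hf' (v p : ℝ × ℝ) (j : Fin 2) : fderiv ℝ (fun q => f q j) p v = fderiv ℝ f p v j :=
    fderiv_apply_pi (hf1.differentiable one_ne_zero).differentiableAt v j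
  have hg' (v p : ℝ × ℝ) (j : Fin 2) :
      fderiv ℝ (fun q => starRingEnd ℂ (g q j)) p v = starRingEnd ℂ (fderiv ℝ g p v j) := by
    rw [← fderiv_apply_pi (hg1.differentiable one_ne_zero).differentiableAt v j]
    exact congrArg (· v) (Complex.conjCLE.comp_fderiv (f := fun q => g q j) (x := p))
  have hcont (j : Fin 2) (v : ℝ × ℝ) : Continuous fun p => fderiv ℝ f p v j :=
    (continuous_apply j).comp ((hf1.continuous_fderiv one_ne_zero).clm_apply continuous_const)
  have hcontg (j : Fin 2) (v : ℝ × ℝ) : Continuous fun p => starRingEnd ℂ (fderiv ℝ g p v j) :=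
    Complex.continuous_conj.comp ((continuous_apply j).comp
      ((hg1.continuous_fderiv one_ne_zero).clm_apply continuous_const))
  have hsupp (j : Fin 2) (v : ℝ × ℝ) : HasCompactSupport fun p => fderiv ℝ f p v j :=
    (hfc.fderiv_apply (𝕜 := ℝ) v).comp_left (g := fun u : Fin 2 → ℂ => u j) rfl
  have hmul (j : Fin 2) (u v : ℝ × ℝ) :
      Integrable fun p => fderiv ℝ f p u j * starRingEnd ℂ (fderiv ℝ g p v j) :=
    ((hcont j u).mul (hcontg j v)).integrable_of_hasCompactSupport (hsupp j u).mul_right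
  have hjac (j : Fin 2) := setIntegral_lowerHalfPlane_jacobian (hfj j) (hgj j) (hfjc j)
  simp only [hf', hg'] at hjac
  have hemb : Topology.IsClosedEmbedding fun t : ℝ => (t, (0 : ℝ)) :=
    .of_continuous_injective_isClosedMap (by fun_prop) (fun a b h => by simpa using h)
      (isClosedMap_prodMk_right 0)
  have hbdry (j : Fin 2) : Integrable fun x : ℝ =>
      f (x, 0) j * starRingEnd ℂ (fderiv ℝ g (x, 0) (1, 0) j) :=
    (((hfj j).continuous.mul (hcontg j (1, 0))).comp
      hemb.continuous).integrable_of_hasCompactSupport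
        ((hfjc j).mul_right.comp_isClosedEmbedding hemb)
  have hJ (j : Fin 2) : IntegrableOn (fun p =>
      fderiv ℝ f p (0, 1) j * starRingEnd ℂ (fderiv ℝ g p (1, 0) j) -
      fderiv ℝ f p (1, 0) j * starRingEnd ℂ (fderiv ℝ g p (0, 1) j)) {q : ℝ × ℝ | q.2 < 0} :=
    ((hmul j _ _).sub (hmul j _ _)).integrableOn
  have hgrad : IntegrableOn (fun p => ip (pd1 f p) (pd1 g p) + ip (pd2 f p) (pd2 g p))
      {q : ℝ × ℝ | q.2 < 0} :=
    (((hmul 0 _ _).add (hmul 1 _ _)).add ((hmul 0 _ _).add (hmul 1 _ _))).integrableOn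
  have hpoint (p : ℝ × ℝ) : ip (sigmaGrad f p) (sigmaGrad g p) =
      ip (pd1 f p) (pd1 g p) + ip (pd2 f p) (pd2 g p) + Complex.I *
        ((fderiv ℝ f p (0, 1) 0 * starRingEnd ℂ (fderiv ℝ g p (1, 0) 0) -
          fderiv ℝ f p (1, 0) 0 * starRingEnd ℂ (fderiv ℝ g p (0, 1) 0)) -
        (fderiv ℝ f p (0, 1) 1 * starRingEnd ℂ (fderiv ℝ g p (1, 0) 1) -
          fderiv ℝ f p (1, 0) 1 * starRingEnd ℂ (fderiv ℝ g p (0, 1) 1))) := by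
    simp only [ip, sigmaGrad, σ1, σ2, pd1, pd2, Matrix.mulVec, dotProduct, Fin.sum_univ_two,
      Pi.add_apply, of_apply, cons_val', cons_val_zero, cons_val_one, cons_val_fin_one, map_add,
      map_mul, map_neg, map_zero, map_one, Complex.conj_I]
    linear_combination (-(fderiv ℝ f p (0, 1) 0 * starRingEnd ℂ (fderiv ℝ g p (0, 1) 0)) -
      fderiv ℝ f p (0, 1) 1 * starRingEnd ℂ (fderiv ℝ g p (0, 1) 1)) * Complex.I_mul_I
  have hboundary (x : ℝ) : ip (f (x, 0)) (Complex.I • σ3.mulVec (pd1 g (x, 0))) =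
      -(Complex.I * (f (x, 0) 0 * starRingEnd ℂ (fderiv ℝ g (x, 0) (1, 0) 0) -
        f (x, 0) 1 * starRingEnd ℂ (fderiv ℝ g (x, 0) (1, 0) 1))) := by
    simp only [ip, σ3, pd1, Matrix.mulVec, dotProduct, Fin.sum_univ_two, Pi.smul_apply,
      smul_eq_mul, of_apply, cons_val', cons_val_zero, cons_val_one, cons_val_fin_one, map_add,
      map_mul, map_neg, map_zero, map_one, Complex.conj_I]
    ring
  simp_rw [hpoint, hboundary]
  rw [integral_add hgrad (((hJ 0).fun_sub (hJ 1)).const_mul _), integral_const_mul,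
    integral_sub (hJ 0) (hJ 1), hjac, hjac, integral_neg, integral_const_mul,
    integral_sub (hbdry 0) (hbdry 1), sub_neg_eq_add]

end
end

section
/- Let ω ∈ (0, π/2), m > 0, and τ ∈ ℝ with τ ∉ {−2, 0, 2}. Let Ω₊ := {(x,y) ∈ ℝ² : x > 0 and |y| < x·tan ω} be the open wedge of half opening angle ω, let Ω₋ := ℝ² ∖ closure(Ω₊), and let Γ_l := {(r cos ω, r sin ω) : r > 0} and Γ_r := {(r cos ω, −r sin ω) : r > 0} be the two edges. Let u₊, u₋ : ℝ² → ℂ² be smooth with compact support and satisfy the transmission conditions u₋(p) = M_l·u₊(p) for all p ∈ Γ_l and u₋(p) = M_r·u₊(p) for all p ∈ Γ_r. Then ∫_{Ω₊} |Du₊|² + ∫_{Ω₋} |Du₋|² = ∫_{Ω₊} (|∂₁u₊|² + |∂₂u₊|²) + ∫_{Ω₋} (|∂₁u₋|² + |∂₂u₋|²) + m²·(∫_{Ω₊} |u₊|² + ∫_{Ω₋} |u₋|²) + (2m/τ)·( ∫₀^∞ |u₊(r cos ω, r sin ω) − u₋(r cos ω, r sin ω)|² dr + ∫₀^∞ |u₊(r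 cos ω, −r sin ω) − u₋(r cos ω, −r sin ω)|² dr ). -/
open Matrix MeasureTheory Real

noncomputable section

/-- The squared Euclidean norm on `ℂ²`. -/
def norm2 (v : Fin 2 → ℂ) : ℝ := Complex.normSq (v 0) + Complex.normSq (v 1)

/-- The Dirac operator `Dh = −i(σ₁∂₁h + σ₂∂₂h) + mσ₃h`. -/
def diracOp (m : ℝ) (h : ℝ × ℝ → Fin 2 → ℂ) (p : ℝ × ℝ) : Fin 2 → ℂ :=
  (-Complex.I) • (σ1.mulVec (pd1 h p) + σ2.mulVec (pd2 h p))
    + ((m : ℝ) : ℂ) • σ3.mulVec (h p)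

/-- The edge transmission matrix `M_l`. -/
def Ml (ω τ : ℝ) : Matrix (Fin 2) (Fin 2) ℂ :=
  ((1 / (1 - τ ^ 2 / 4) : ℝ) : ℂ) •
    !![((1 + τ ^ 2 / 4 : ℝ) : ℂ), (τ : ℂ) * Complex.exp (-(Complex.I * (ω : ℂ)));
       (τ : ℂ) * Complex.exp (Complex.I * (ω : ℂ)), ((1 + τ ^ 2 / 4 : ℝ) : ℂ)]

/-- The edge transmission matrix `M_r`. -/
def Mr (ω τ : ℝ) : Matrix (Fin 2) (Fin 2) ℂ :=
  ((1 / (1 - τ ^ 2 / 4) : ℝ) : ℂ) •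
    !![((1 + τ ^ 2 / 4 : ℝ) : ℂ), -((τ : ℂ) * Complex.exp (Complex.I * (ω : ℂ)));
       -((τ : ℂ) * Complex.exp (-(Complex.I * (ω : ℂ)))), ((1 + τ ^ 2 / 4 : ℝ) : ℂ)]

/-- The open wedge of half opening angle `ω`. -/
def wedge (ω : ℝ) : Set (ℝ × ℝ) := {p : ℝ × ℝ | 0 < p.1 ∧ |p.2| < p.1 * Real.tan ω}

/-- On the image of the open quadrant under an invertible linear map, the integral of the
derivative along the second generator reduces to an integral over the ray spanned by the first. -/
lemma setIntegral_fderiv_image_quadrant {a b c d : ℝ} (hdet : a * d - b * c ≠ 0)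
    {g : ℝ × ℝ → ℝ} (hg : ContDiff ℝ 1 g) (hgc : HasCompactSupport g) :
    ∫ p in (fun q : ℝ × ℝ => (a * q.1 + b * q.2, c * q.1 + d * q.2)) ''
        (Set.Ioi 0 ×ˢ Set.Ioi 0), fderiv ℝ g p (b, d)
      = -(|a * d - b * c| * ∫ s in Set.Ioi (0 : ℝ), g (a * s, c * s)) := by
  set L : ℝ × ℝ →L[ℝ] ℝ × ℝ := LinearMap.toContinuousLinearMap
    (Matrix.toLin (Module.Basis.finTwoProd ℝ) (Module.Basis.finTwoProd ℝ) !![a, b; c, d]) with hL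
  have hLapp : ∀ q : ℝ × ℝ, L q = (a * q.1 + b * q.2, c * q.1 + d * q.2) := by
    intro q
    simp [hL, Matrix.toLin_finTwoProd_apply]
  have hLdet : L.det = a * d - b * c := by
    simp [hL, LinearMap.det_toContinuousLinearMap, LinearMap.det_toLin, Matrix.det_fin_two_of]
  have hLfun : (fun q : ℝ × ℝ => (a * q.1 + b * q.2, c * q.1 + d * q.2)) = L :=
    funext fun q => (hLapp q).symm
  have hinj : Function.Injective L := by
    rw [injective_iff_map_eq_zero]
    intro q hq
    rw [hLapp, Prod.mk_eq_zero] at hq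
    obtain ⟨h1, h2⟩ := hq
    ext
    · exact (mul_eq_zero.1 (by linear_combination d * h1 - b * h2 :
        (a * d - b * c) * q.1 = 0)).resolve_left hdet
    · exact (mul_eq_zero.1 (by linear_combination a * h2 - c * h1 :
        (a * d - b * c) * q.2 = 0)).resolve_left hdet
  have hemb : Topology.IsClosedEmbedding L :=
    LinearMap.isClosedEmbedding_of_injective (f := (L : ℝ × ℝ →ₗ[ℝ] ℝ × ℝ))
      (LinearMap.ker_eq_bot.2 hinj)
  have hcomp : ContDiff ℝ 1 (g ∘ L) := hg.comp L.contDiff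
  have hcompc : HasCompactSupport (g ∘ L) := hgc.comp_isClosedEmbedding hemb
  have hcont : Continuous fun q => fderiv ℝ g (L q) (b, d) :=
    ((hg.continuous_fderiv one_ne_zero).comp L.continuous).clm_apply continuous_const
  have hcs : HasCompactSupport fun q => fderiv ℝ g (L q) (b, d) :=
    (hgc.fderiv_apply ℝ (b, d)).comp_isClosedEmbedding hemb
  have hinner : ∀ s : ℝ, ∫ t in Set.Ioi (0 : ℝ), fderiv ℝ g (L (s, t)) (b, d) =
      -g (a * s, c * s) := by
    intro s
    have hline : Topology.IsClosedEmbedding fun t : ℝ => ((s, t) : ℝ × ℝ) :=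
      Topology.IsClosedEmbedding.of_continuous_injective_isClosedMap (by fun_prop)
        (fun x y h => (Prod.mk.inj h).2) (isClosedMap_prodMk_left s)
    have h := HasCompactSupport.integral_Ioi_deriv_eq
      (f := fun t : ℝ => g (L (s, t))) (hcomp.comp (contDiff_const.prodMk contDiff_id))
      (hcompc.comp_isClosedEmbedding hline) 0
    have hd : ∀ t : ℝ, deriv (fun t : ℝ => g (L (s, t))) t = fderiv ℝ g (L (s, t)) (b, d) := by
      intro t
      have h1 : HasDerivAt (fun t : ℝ => L (s, t)) (L (0, 1)) t :=
        L.hasFDerivAt.comp_hasDerivAt t ((hasDerivAt_const t s).prodMk (hasDerivAt_id t))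
      have h2 := ((hg.differentiable one_ne_zero) (L (s, t))).hasFDerivAt.comp_hasDerivAt t h1
      have h3 : L (0, 1) = (b, d) := by simp [hLapp]
      rw [h3] at h2
      exact h2.deriv
    simp only [hd] at h
    rw [h]
    simp [hLapp]
  rw [hLfun, integral_image_eq_integral_abs_det_fderiv_smul volume
    (measurableSet_Ioi.prod measurableSet_Ioi) (fun x _ => L.hasFDerivAt.hasFDerivWithinAt)
    hinj.injOn]
  simp only [hLdet, smul_eq_mul]
  rw [integral_const_mul, Measure.volume_eq_prod,
    setIntegral_prod _ (hcont.integrable_of_hasCompactSupport hcs).integrableOn]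
  simp only [hinner, integral_neg, mul_neg]

lemma integral_fderiv_apply_eq_zero {g : ℝ × ℝ → ℝ} (hg : ContDiff ℝ 1 g)
    (hgc : HasCompactSupport g) (v : ℝ × ℝ) : ∫ p, fderiv ℝ g p v = 0 := by
  have hi : Integrable fun p => fderiv ℝ g p v :=
    ((hg.continuous_fderiv one_ne_zero).clm_apply
      continuous_const).integrable_of_hasCompactSupport (hgc.fderiv_apply ℝ v)
  have h := integral_mul_fderiv_eq_neg_fderiv_mul_of_integrable (μ := volume)
    (f := fun _ : ℝ × ℝ => (1 : ℝ)) (g := g) (v := v) (by simp) (by simpa using hi)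
    (by simpa using hg.continuous.integrable_of_hasCompactSupport hgc)
    (fun x _ => differentiableAt_const _) (fun x _ => hg.differentiable one_ne_zero x)
  simpa using h

lemma wedge_eq_image_quadrant {ω : ℝ} (hω : ω ∈ Set.Ioo 0 (π / 2)) :
    wedge ω = (fun q : ℝ × ℝ => (cos ω * q.1 + cos ω * q.2, -sin ω * q.1 + sin ω * q.2)) ''
      (Set.Ioi 0 ×ˢ Set.Ioi 0) := by
  have hc : 0 < cos ω := cos_pos_of_mem_Ioo ⟨by linarith [hω.1, pi_pos], hω.2⟩
  have hs : 0 < sin ω := sin_pos_of_pos_of_lt_pi hω.1 (by linarith [hω.2, pi_pos])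
  ext ⟨x, y⟩
  simp only [wedge, Set.mem_ofPred_eq, Set.mem_image, Set.mem_prod, Set.mem_Ioi, Prod.exists,
    Prod.mk.injEq, abs_lt, tan_eq_sin_div_cos]
  constructor
  · rintro ⟨-, h1, h2⟩
    rw [mul_div_assoc', ← neg_div, div_lt_iff₀ hc] at h1
    rw [mul_div_assoc', lt_div_iff₀ hc] at h2
    refine ⟨(x * sin ω - y * cos ω) / (2 * sin ω * cos ω),
      (x * sin ω + y * cos ω) / (2 * sin ω * cos ω), ⟨?_, ?_⟩, ?_, ?_⟩
    · apply div_pos <;> [linarith; positivity]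
    · apply div_pos <;> [linarith; positivity]
    · field_simp
      ring
    · field_simp
      ring
  · rintro ⟨s, t, ⟨hs', ht⟩, rfl, rfl⟩
    refine ⟨by positivity, ?_, ?_⟩
    · rw [mul_div_assoc', ← neg_div, div_lt_iff₀ hc]
      nlinarith [mul_pos (mul_pos hc hs) ht]
    · rw [mul_div_assoc', lt_div_iff₀ hc]
      nlinarith [mul_pos (mul_pos hc hs) hs']

lemma wedge_eq_image_quadrant_swap {ω : ℝ} (hω : ω ∈ Set.Ioo 0 (π / 2)) :
    wedge ω = (fun q : ℝ × ℝ => (cos ω * q.1 + cos ω * q.2, sin ω * q.1 + -sin ω * q.2)) ''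
      (Set.Ioi 0 ×ˢ Set.Ioi 0) := by
  rw [wedge_eq_image_quadrant hω]
  ext p
  simp only [Set.mem_image, Set.mem_prod, Set.mem_Ioi, Prod.exists]
  constructor <;>
  · rintro ⟨s, t, ⟨hs, ht⟩, rfl⟩
    exact ⟨t, s, ⟨ht, hs⟩, by simp only [Prod.mk.injEq]; constructor <;> ring⟩

/-- Divergence theorem on the wedge, in coordinates. -/
lemma setIntegral_wedge_div {ω : ℝ} (hω : ω ∈ Set.Ioo 0 (π / 2)) {F G : ℝ × ℝ → ℝ}
    (hF : ContDiff ℝ 1 F) (hFc : HasCompactSupport F)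
    (hG : ContDiff ℝ 1 G) (hGc : HasCompactSupport G) :
    ∫ p in wedge ω, (fderiv ℝ F p (1, 0) + fderiv ℝ G p (0, 1))
      = (∫ r in Set.Ioi (0 : ℝ), (-sin ω * F (r * cos ω, r * sin ω)
            + cos ω * G (r * cos ω, r * sin ω)))
        + ∫ r in Set.Ioi (0 : ℝ), (-sin ω * F (r * cos ω, -(r * sin ω))
            - cos ω * G (r * cos ω, -(r * sin ω))) := by
  have hc : 0 < cos ω := cos_pos_of_mem_Ioo ⟨by linarith [hω.1, pi_pos], hω.2⟩
  have hs : 0 < sin ω := sin_pos_of_pos_of_lt_pi hω.1 (by linarith [hω.2, pi_pos])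
  set J := 2 * sin ω * cos ω with hJ
  have hJpos : 0 < J := by positivity
  have hlc : ∀ a b : ℝ, ContDiff ℝ 1 (fun p => a * F p + b * G p) := fun a b =>
    (contDiff_const.mul hF).add (contDiff_const.mul hG)
  have hlcc : ∀ a b : ℝ, HasCompactSupport (fun p => a * F p + b * G p) := fun a b =>
    (hFc.mul_left (f := fun _ => a)).add (hGc.mul_left (f := fun _ => b))
  have hfd : ∀ (a b : ℝ) (p v : ℝ × ℝ), fderiv ℝ (fun p => a * F p + b * G p) p v
      = a * fderiv ℝ F p v + b * fderiv ℝ G p v := by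
    intro a b p v
    have hF' := (hF.differentiable one_ne_zero p).hasFDerivAt
    have hG' := (hG.differentiable one_ne_zero p).hasFDerivAt
    rw [(HasFDerivAt.fun_add (hF'.const_mul a) (hG'.const_mul b)).fderiv]
    simp
  have hv : ∀ (H : ℝ × ℝ → ℝ) (p : ℝ × ℝ) (a b : ℝ), fderiv ℝ H p (a, b)
      = a * fderiv ℝ H p (1, 0) + b * fderiv ℝ H p (0, 1) := by
    intro H p a b
    rw [show ((a, b) : ℝ × ℝ) = a • (1, 0) + b • (0, 1) by simp, map_add, map_smul, map_smul]
    simp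
  have hint : ∀ (a b : ℝ) (v : ℝ × ℝ), IntegrableOn
      (fun p => fderiv ℝ (fun p => a * F p + b * G p) p v) (wedge ω) := fun a b v =>
    ((((hlc a b).continuous_fderiv one_ne_zero).clm_apply
      continuous_const).integrable_of_hasCompactSupport
        ((hlcc a b).fderiv_apply ℝ v)).integrableOn
  have h1 := setIntegral_fderiv_image_quadrant (a := cos ω) (b := cos ω) (c := -sin ω)
    (d := sin ω) (by rw [show cos ω * sin ω - cos ω * -sin ω = J by rw [hJ]; ring]; exact hJpos.ne')
    (hlc (sin ω / J) (cos ω / J)) (hlcc _ _)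
  have h2 := setIntegral_fderiv_image_quadrant (a := cos ω) (b := cos ω) (c := sin ω)
    (d := -sin ω)
    (by rw [show cos ω * -sin ω - cos ω * sin ω = -J by rw [hJ]; ring]
        exact neg_ne_zero.2 hJpos.ne')
    (hlc (sin ω / J) (-cos ω / J)) (hlcc _ _)
  rw [← wedge_eq_image_quadrant hω,
    show |cos ω * sin ω - cos ω * -sin ω| = J by
      rw [show cos ω * sin ω - cos ω * -sin ω = J by rw [hJ]; ring, abs_of_pos hJpos],
    ← integral_const_mul, ← integral_neg] at h1
  rw [← wedge_eq_image_quadrant_swap hω,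
    show |cos ω * -sin ω - cos ω * sin ω| = J by
      rw [show cos ω * -sin ω - cos ω * sin ω = -J by rw [hJ]; ring, abs_neg, abs_of_pos hJpos],
    ← integral_const_mul, ← integral_neg] at h2
  calc _ = ∫ p in wedge ω,
        (fderiv ℝ (fun p => sin ω / J * F p + -cos ω / J * G p) p (cos ω, -sin ω)
        + fderiv ℝ (fun p => sin ω / J * F p + cos ω / J * G p) p (cos ω, sin ω)) := by
        congr 1
        ext p
        rw [hfd, hfd, hv F p (cos ω), hv F p (cos ω), hv G p (cos ω), hv G p (cos ω), hJ]
        field_simp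
        ring
    _ = _ := by
        rw [integral_add (hint _ _ _) (hint _ _ _), h1, h2]
        congr 2 <;>
        · ext r
          simp only [mul_comm r, neg_mul]
          field_simp
          ring

lemma setIntegral_wedge_compl_div {ω : ℝ} {F G : ℝ × ℝ → ℝ}
    (hF : ContDiff ℝ 1 F) (hFc : HasCompactSupport F)
    (hG : ContDiff ℝ 1 G) (hGc : HasCompactSupport G) :
    ∫ p in (closure (wedge ω))ᶜ, (fderiv ℝ F p (1, 0) + fderiv ℝ G p (0, 1))
      = -∫ p in wedge ω, (fderiv ℝ F p (1, 0) + fderiv ℝ G p (0, 1)) := by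
  have hi : ∀ {H : ℝ × ℝ → ℝ} (v : ℝ × ℝ), ContDiff ℝ 1 H → HasCompactSupport H →
      Integrable fun p => fderiv ℝ H p v := fun v hH hHc =>
    ((hH.continuous_fderiv one_ne_zero).clm_apply
      continuous_const).integrable_of_hasCompactSupport (hHc.fderiv_apply ℝ v)
  have hconv : Convex ℝ (wedge ω) := by
    intro p hp q hq a b ha hb hab
    simp only [wedge, Set.mem_ofPred_eq, abs_lt, Prod.fst_add, Prod.snd_add, Prod.smul_fst,
      Prod.smul_snd, smul_eq_mul] at *
    obtain ⟨hp1, hp2, hp3⟩ := hp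
    obtain ⟨hq1, hq2, hq3⟩ := hq
    rcases ha.eq_or_lt with rfl | ha
    · obtain rfl : b = 1 := by linarith
      simpa using ⟨hq1, hq2, hq3⟩
    · refine ⟨by positivity, ?_, ?_⟩ <;>
        nlinarith
  have hae : closure (wedge ω) =ᵐ[volume] wedge ω :=
    closure_ae_eq_of_null_frontier (hconv.addHaar_frontier volume)
  rw [setIntegral_compl isClosed_closure.measurableSet
      (Integrable.fun_add (hi _ hF hFc) (hi _ hG hGc)),
    setIntegral_congr_set hae, integral_add (hi _ hF hFc) (hi _ hG hGc),
    integral_fderiv_apply_eq_zero hF hFc, integral_fderiv_apply_eq_zero hG hGc]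
  simp

/-- The current `Im(ā ∂ᵥa) - Im(b̄ ∂ᵥb)` of `h = (a, b)` in the direction `v`. -/
def current (h : ℝ × ℝ → Fin 2 → ℂ) (v p : ℝ × ℝ) : ℝ :=
  ((h p 0).re * (fderiv ℝ h p v 0).im - (h p 0).im * (fderiv ℝ h p v 0).re)
    - ((h p 1).re * (fderiv ℝ h p v 1).im - (h p 1).im * (fderiv ℝ h p v 1).re)

/-- First component of the flux whose divergence is the difference between `|Dh|²` and
`|∇h|² + m²|h|²`. -/
def flux1 (m : ℝ) (h : ℝ × ℝ → Fin 2 → ℂ) (p : ℝ × ℝ) : ℝ :=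
  2 * m * ((h p 0).re * (h p 1).im - (h p 0).im * (h p 1).re) - current h (0, 1) p

/-- Second component of the flux whose divergence is the difference between `|Dh|²` and
`|∇h|² + m²|h|²`. -/
def flux2 (m : ℝ) (h : ℝ × ℝ → Fin 2 → ℂ) (p : ℝ × ℝ) : ℝ :=
  current h (1, 0) p - 2 * m * ((h p 0).re * (h p 1).re + (h p 0).im * (h p 1).im)

lemma fderiv_re_apply {h : ℝ × ℝ → Fin 2 → ℂ} {p : ℝ × ℝ} (hh : DifferentiableAt ℝ h p)
    (i : Fin 2) (v : ℝ × ℝ) :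
    fderiv ℝ (fun x => (h x i).re) p v = (fderiv ℝ h p v i).re := by
  have h1 := hasFDerivAt_pi'.1 hh.hasFDerivAt i
  have h2 : HasFDerivAt (fun x => (h x i).re) _ p := Complex.reCLM.hasFDerivAt.comp p h1
  rw [h2.fderiv]
  rfl

lemma fderiv_im_apply {h : ℝ × ℝ → Fin 2 → ℂ} {p : ℝ × ℝ} (hh : DifferentiableAt ℝ h p)
    (i : Fin 2) (v : ℝ × ℝ) :
    fderiv ℝ (fun x => (h x i).im) p v = (fderiv ℝ h p v i).im := by
  have h1 := hasFDerivAt_pi'.1 hh.hasFDerivAt i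
  have h2 : HasFDerivAt (fun x => (h x i).im) _ p := Complex.imCLM.hasFDerivAt.comp p h1
  rw [h2.fderiv]
  rfl

lemma contDiff_re {n : WithTop ℕ∞} {h : ℝ × ℝ → Fin 2 → ℂ} (hh : ContDiff ℝ n h) (i : Fin 2) :
    ContDiff ℝ n fun x => (h x i).re :=
  Complex.reCLM.contDiff.comp (contDiff_pi.1 hh i)

lemma contDiff_im {n : WithTop ℕ∞} {h : ℝ × ℝ → Fin 2 → ℂ} (hh : ContDiff ℝ n h) (i : Fin 2) :
    ContDiff ℝ n fun x => (h x i).im :=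
  Complex.imCLM.contDiff.comp (contDiff_pi.1 hh i)

lemma ContDiff.fderiv_fun_apply {E F : Type*} [NormedAddCommGroup E] [NormedSpace ℝ E]
    [NormedAddCommGroup F] [NormedSpace ℝ F] {f : E → F} (hf : ContDiff ℝ 2 f) (v : E) :
    ContDiff ℝ 1 fun x => fderiv ℝ f x v :=
  (hf.fderiv_right (by norm_num)).clm_apply contDiff_const

lemma contDiff_current {h : ℝ × ℝ → Fin 2 → ℂ} (hh : ContDiff ℝ 2 h) (v : ℝ × ℝ) :
    ContDiff ℝ 1 (current h v) := by
  have h1 := hh.of_le (m := 1) (by norm_num)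
  have hd := hh.fderiv_fun_apply v
  exact (((contDiff_re h1 0).mul (contDiff_im hd 0)).sub
      ((contDiff_im h1 0).mul (contDiff_re hd 0))).sub
    (((contDiff_re h1 1).mul (contDiff_im hd 1)).sub
      ((contDiff_im h1 1).mul (contDiff_re hd 1)))

lemma contDiff_flux1 (m : ℝ) {h : ℝ × ℝ → Fin 2 → ℂ} (hh : ContDiff ℝ 2 h) :
    ContDiff ℝ 1 (flux1 m h) := by
  have h1 := hh.of_le (m := 1) (by norm_num)
  exact (contDiff_const.mul (((contDiff_re h1 0).mul (contDiff_im h1 1)).sub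
    ((contDiff_im h1 0).mul (contDiff_re h1 1)))).sub (contDiff_current hh _)

lemma contDiff_flux2 (m : ℝ) {h : ℝ × ℝ → Fin 2 → ℂ} (hh : ContDiff ℝ 2 h) :
    ContDiff ℝ 1 (flux2 m h) := by
  have h1 := hh.of_le (m := 1) (by norm_num)
  exact (contDiff_current hh _).sub (contDiff_const.mul
    (((contDiff_re h1 0).mul (contDiff_re h1 1)).add ((contDiff_im h1 0).mul (contDiff_im h1 1))))

lemma hasCompactSupport_flux1 (m : ℝ) {h : ℝ × ℝ → Fin 2 → ℂ} (hh : HasCompactSupport h) :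
    HasCompactSupport (flux1 m h) :=
  hh.mono fun p hp hp0 => hp (by simp [flux1, current, hp0])

lemma hasCompactSupport_flux2 (m : ℝ) {h : ℝ × ℝ → Fin 2 → ℂ} (hh : HasCompactSupport h) :
    HasCompactSupport (flux2 m h) :=
  hh.mono fun p hp hp0 => hp (by simp [flux2, current, hp0])

/-- The antisymmetrized derivative of `f ∇g - g ∇f` is twice the Jacobian of `(f, g)`. -/
lemma fderiv_wronskian_sub {f g : ℝ × ℝ → ℝ} (hf : ContDiff ℝ 2 f) (hg : ContDiff ℝ 2 g)
    (p v w : ℝ × ℝ) :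
    fderiv ℝ (fun x => f x * fderiv ℝ g x w - g x * fderiv ℝ f x w) p v
      - fderiv ℝ (fun x => f x * fderiv ℝ g x v - g x * fderiv ℝ f x v) p w
      = 2 * (fderiv ℝ f p v * fderiv ℝ g p w - fderiv ℝ f p w * fderiv ℝ g p v) := by
  have key : ∀ u z : ℝ × ℝ, fderiv ℝ (fun x => f x * fderiv ℝ g x u - g x * fderiv ℝ f x u) p z
      = f p * fderiv ℝ (fderiv ℝ g) p z u + fderiv ℝ g p u * fderiv ℝ f p z
        - (g p * fderiv ℝ (fderiv ℝ f) p z u + fderiv ℝ f p u * fderiv ℝ g p z) := by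
    intro u z
    have h1 : ∀ {k : ℝ × ℝ → ℝ}, ContDiff ℝ 2 k → HasFDerivAt (fun x => fderiv ℝ k x u)
        ((fderiv ℝ (fderiv ℝ k) p).flip u) p := by
      intro k hk
      have h2 : DifferentiableAt ℝ (fderiv ℝ k) p :=
        (hk.fderiv_right (m := 1) (by norm_num)).differentiable one_ne_zero p
      simpa using h2.hasFDerivAt.clm_apply (hasFDerivAt_const u p)
    have hf1 := (hf.differentiable two_ne_zero p).hasFDerivAt
    have hg1 := (hg.differentiable two_ne_zero p).hasFDerivAt
    rw [(HasFDerivAt.fun_sub (hf1.fun_mul (h1 hg)) (hg1.fun_mul (h1 hf))).fderiv]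
    simp
  have hfs : fderiv ℝ (fderiv ℝ f) p v w = fderiv ℝ (fderiv ℝ f) p w v :=
    (hf.contDiffAt.isSymmSndFDerivAt (by simp)) v w
  have hgs : fderiv ℝ (fderiv ℝ g) p v w = fderiv ℝ (fderiv ℝ g) p w v :=
    (hg.contDiffAt.isSymmSndFDerivAt (by simp)) v w
  rw [key, key, hfs, hgs]
  ring

lemma fderiv_flux {h : ℝ × ℝ → Fin 2 → ℂ} (hh : ContDiff ℝ 2 h) (m : ℝ) (p : ℝ × ℝ) :
    fderiv ℝ (flux1 m h) p (1, 0) + fderiv ℝ (flux2 m h) p (0, 1)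
      = -2 * ((pd1 h p 0).re * (pd2 h p 0).im - (pd2 h p 0).re * (pd1 h p 0).im)
        + 2 * ((pd1 h p 1).re * (pd2 h p 1).im - (pd2 h p 1).re * (pd1 h p 1).im)
        + 2 * m * ((h p 0).re * (pd1 h p 1).im + (pd1 h p 0).re * (h p 1).im
            - (h p 0).im * (pd1 h p 1).re - (pd1 h p 0).im * (h p 1).re)
        - 2 * m * ((h p 0).re * (pd2 h p 1).re + (pd2 h p 0).re * (h p 1).re
            + (h p 0).im * (pd2 h p 1).im + (pd2 h p 0).im * (h p 1).im) := by
  have hd := hh.differentiable two_ne_zero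
  set W : Fin 2 → ℝ × ℝ → ℝ × ℝ → ℝ := fun i v x =>
    (h x i).re * fderiv ℝ (fun x => (h x i).im) x v
      - (h x i).im * fderiv ℝ (fun x => (h x i).re) x v with hW
  have hcur : ∀ v, current h v = fun x => W 0 v x - W 1 v x := by
    intro v
    ext x
    simp only [hW, current, fderiv_re_apply (hd x), fderiv_im_apply (hd x)]
  have hWd : ∀ i v, HasFDerivAt (W i v) (fderiv ℝ (W i v) p) p := by
    intro i v
    refine DifferentiableAt.hasFDerivAt (ContDiff.differentiable (n := 1) ?_ one_ne_zero p)
    have h1 := hh.of_le (m := 1) (by norm_num)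
    exact ((contDiff_re h1 i).mul ((contDiff_im hh i).fderiv_fun_apply v)).sub
      ((contDiff_im h1 i).mul ((contDiff_re hh i).fderiv_fun_apply v))
  have hre : ∀ i, HasFDerivAt (fun x => (h x i).re) (fderiv ℝ (fun x => (h x i).re) p) p :=
    fun i => ((contDiff_re hh i).differentiable two_ne_zero p).hasFDerivAt
  have him : ∀ i, HasFDerivAt (fun x => (h x i).im) (fderiv ℝ (fun x => (h x i).im) p) p :=
    fun i => ((contDiff_im hh i).differentiable two_ne_zero p).hasFDerivAt
  have hfl1 : flux1 m h = fun x =>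
      2 * m * ((h x 0).re * (h x 1).im - (h x 0).im * (h x 1).re)
        - (W 0 (0, 1) x - W 1 (0, 1) x) := by
    ext x
    rw [flux1, hcur]
  have hfl2 : flux2 m h = fun x => (W 0 (1, 0) x - W 1 (1, 0) x)
      - 2 * m * ((h x 0).re * (h x 1).re + (h x 0).im * (h x 1).im) := by
    ext x
    rw [flux2, hcur]
  have h1 := HasFDerivAt.fun_sub ((HasFDerivAt.fun_sub ((hre 0).fun_mul (him 1))
      ((him 0).fun_mul (hre 1))).const_mul (2 * m)) (HasFDerivAt.fun_sub (hWd 0 (0, 1)) (hWd 1 (0, 1)))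
  have h2 := HasFDerivAt.fun_sub (HasFDerivAt.fun_sub (hWd 0 (1, 0)) (hWd 1 (1, 0)))
      ((HasFDerivAt.fun_add ((hre 0).fun_mul (hre 1))
      ((him 0).fun_mul (him 1))).const_mul (2 * m))
  have hw0 := fderiv_wronskian_sub (contDiff_re hh 0) (contDiff_im hh 0) p (1, 0) (0, 1)
  have hw1 := fderiv_wronskian_sub (contDiff_re hh 1) (contDiff_im hh 1) p (1, 0) (0, 1)
  rw [hfl1, hfl2, h1.fderiv, h2.fderiv]
  change fderiv ℝ (W 0 (0, 1)) p (1, 0) - fderiv ℝ (W 0 (1, 0)) p (0, 1) = _ at hw0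
  change fderiv ℝ (W 1 (0, 1)) p (1, 0) - fderiv ℝ (W 1 (1, 0)) p (0, 1) = _ at hw1
  simp only [fderiv_re_apply (hd p), fderiv_im_apply (hd p)] at hw0 hw1
  simp only [_root_.sub_apply, _root_.add_apply, _root_.smul_apply,
    smul_eq_mul, fderiv_re_apply (hd p), fderiv_im_apply (hd p), pd1, pd2]
  linear_combination -hw0 + hw1

lemma norm2_diracOp {h : ℝ × ℝ → Fin 2 → ℂ} (hh : ContDiff ℝ 2 h) (m : ℝ) (p : ℝ × ℝ) :
    norm2 (diracOp m h p) = (norm2 (pd1 h p) + norm2 (pd2 h p)) + m ^ 2 * norm2 (h p)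
      + (fderiv ℝ (flux1 m h) p (1, 0) + fderiv ℝ (flux2 m h) p (0, 1)) := by
  rw [fderiv_flux hh]
  simp only [norm2, diracOp, σ1, σ2, σ3, Complex.normSq_apply, Matrix.mulVec, dotProduct,
    Fin.sum_univ_two, Pi.add_apply, Pi.smul_apply, smul_eq_mul, Matrix.of_apply,
    Matrix.cons_val', Matrix.cons_val_zero, Matrix.cons_val_one, Matrix.cons_val_fin_one,
    Complex.add_re, Complex.add_im, Complex.mul_re, Complex.mul_im, Complex.neg_re,
    Complex.neg_im, Complex.I_re, Complex.I_im, Complex.ofReal_re, Complex.ofReal_im,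
    Complex.zero_re, Complex.zero_im, Complex.one_re, Complex.one_im]
  ring

lemma continuous_norm2 : Continuous norm2 := by
  unfold norm2
  exact (Complex.continuous_normSq.comp (continuous_apply 0)).add
    (Complex.continuous_normSq.comp (continuous_apply 1))

lemma norm2_zero : norm2 0 = 0 := by simp [norm2]

lemma Continuous.integrable_norm2 {X : Type*} [TopologicalSpace X] [MeasurableSpace X]
    [OpensMeasurableSpace X] {μ : Measure X} [IsFiniteMeasureOnCompacts μ] {f : X → Fin 2 → ℂ}
    (hf : Continuous f) (hfc : HasCompactSupport f) : Integrable (fun x => norm2 (f x)) μ :=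
  (continuous_norm2.comp hf).integrable_of_hasCompactSupport (hfc.comp_left norm2_zero)

lemma setIntegral_norm2_diracOp {h : ℝ × ℝ → Fin 2 → ℂ} (hh : ContDiff ℝ 2 h)
    (hc : HasCompactSupport h) (m : ℝ) (s : Set (ℝ × ℝ)) :
    ∫ p in s, norm2 (diracOp m h p) = (∫ p in s, (norm2 (pd1 h p) + norm2 (pd2 h p)))
      + m ^ 2 * (∫ p in s, norm2 (h p))
      + ∫ p in s, (fderiv ℝ (flux1 m h) p (1, 0) + fderiv ℝ (flux2 m h) p (0, 1)) := by
  have hi : ∀ {H : ℝ × ℝ → ℝ} (v : ℝ × ℝ), ContDiff ℝ 1 H → HasCompactSupport H →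
      Integrable fun p => fderiv ℝ H p v := fun v hH hHc =>
    ((hH.continuous_fderiv one_ne_zero).clm_apply
      continuous_const).integrable_of_hasCompactSupport (hHc.fderiv_apply ℝ v)
  have hg : ∀ v : ℝ × ℝ, Integrable fun p => norm2 (fderiv ℝ h p v) := fun v =>
    (hh.fderiv_fun_apply v).continuous.integrable_norm2 (hc.fderiv_apply ℝ v)
  have hgrad : Integrable fun p => norm2 (pd1 h p) + norm2 (pd2 h p) := (hg _).fun_add (hg _)
  have hmass : Integrable fun p => m ^ 2 * norm2 (h p) :=
    (hh.continuous.integrable_norm2 hc).const_mul _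
  have hdiv : Integrable fun p =>
      fderiv ℝ (flux1 m h) p (1, 0) + fderiv ℝ (flux2 m h) p (0, 1) :=
    Integrable.fun_add (hi _ (contDiff_flux1 m hh) (hasCompactSupport_flux1 m hc))
      (hi _ (contDiff_flux2 m hh) (hasCompactSupport_flux2 m hc))
  simp only [norm2_diracOp hh]
  rw [integral_add (hgrad.fun_add hmass).integrableOn hdiv.integrableOn,
    integral_add hgrad.integrableOn hmass.integrableOn, integral_const_mul]

/-- The transmission matrix of the edge spanned by `±(c, s)`. -/
def edgeMatrix (τ c s : ℝ) : Matrix (Fin 2) (Fin 2) ℂ :=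
  ((1 / (1 - τ ^ 2 / 4) : ℝ) : ℂ) •
    !![((1 + τ ^ 2 / 4 : ℝ) : ℂ), (τ : ℂ) * (c - s * Complex.I);
       (τ : ℂ) * (c + s * Complex.I), ((1 + τ ^ 2 / 4 : ℝ) : ℂ)]

lemma Ml_eq_edgeMatrix (ω τ : ℝ) : Ml ω τ = edgeMatrix τ (cos ω) (sin ω) := by
  have h1 : Complex.exp (Complex.I * ω) = cos ω + sin ω * Complex.I := by
    rw [mul_comm, Complex.exp_mul_I, Complex.ofReal_cos, Complex.ofReal_sin]
  have h2 : Complex.exp (-(Complex.I * ω)) = cos ω - sin ω * Complex.I := by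
    rw [mul_comm, ← neg_mul, Complex.exp_mul_I, Complex.ofReal_cos, Complex.ofReal_sin,
      Complex.cos_neg, Complex.sin_neg]
    ring
  rw [Ml, edgeMatrix, h1, h2]

lemma Mr_eq_edgeMatrix (ω τ : ℝ) : Mr ω τ = edgeMatrix τ (-cos ω) (sin ω) := by
  have h1 : Complex.exp (Complex.I * ω) = cos ω + sin ω * Complex.I := by
    rw [mul_comm, Complex.exp_mul_I, Complex.ofReal_cos, Complex.ofReal_sin]
  have h2 : Complex.exp (-(Complex.I * ω)) = cos ω - sin ω * Complex.I := by
    rw [mul_comm, ← neg_mul, Complex.exp_mul_I, Complex.ofReal_cos, Complex.ofReal_sin,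
      Complex.cos_neg, Complex.sin_neg]
    ring
  rw [Mr, edgeMatrix, h1, h2]
  congr! 5 <;> push_cast <;> ring

/-- A linear relation between two functions along an open ray passes to their derivatives
along that ray. -/
lemma fderiv_ray_eq_mulVec {u w : ℝ × ℝ → Fin 2 → ℂ} (hu : Differentiable ℝ u)
    (hw : Differentiable ℝ w) {A : Matrix (Fin 2) (Fin 2) ℂ} {v : ℝ × ℝ}
    (h : ∀ r : ℝ, 0 < r → w (r • v) = A.mulVec (u (r • v))) {r : ℝ} (hr : 0 < r) :
    fderiv ℝ w (r • v) v = A.mulVec (fderiv ℝ u (r • v) v) := by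
  have hray : HasDerivAt (fun r : ℝ => r • v) v r := by
    simpa using (hasDerivAt_id r).smul_const v
  have h1 : HasDerivAt (fun r : ℝ => w (r • v)) (fderiv ℝ w (r • v) v) r :=
    (hw (r • v)).hasFDerivAt.comp_hasDerivAt r hray
  have h2 : HasDerivAt (fun r : ℝ => u (r • v)) (fderiv ℝ u (r • v) v) r :=
    (hu (r • v)).hasFDerivAt.comp_hasDerivAt r hray
  have h3 : HasDerivAt (fun r : ℝ => A.mulVec (u (r • v)))
      (A.mulVec (fderiv ℝ u (r • v) v)) r :=
    (LinearMap.toContinuousLinearMap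
      (A.mulVecLin.restrictScalars ℝ)).hasFDerivAt.comp_hasDerivAt r h2
  refine h1.unique (h3.congr_of_eventuallyEq ?_)
  filter_upwards [lt_mem_nhds hr] with t ht using h t ht

/-- The jump of the normal flux across an edge. -/
lemma flux_jump {τ c s m : ℝ} (hτ0 : τ ≠ 0) (hD : 1 - τ ^ 2 / 4 ≠ 0) (hcs : c ^ 2 + s ^ 2 = 1)
    {u w : ℝ × ℝ → Fin 2 → ℂ} {p : ℝ × ℝ} (h0 : w p = (edgeMatrix τ c s).mulVec (u p))
    (h1 : fderiv ℝ w p (c, s) = (edgeMatrix τ c s).mulVec (fderiv ℝ u p (c, s))) :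
    (-s * flux1 m u p + c * flux2 m u p) - (-s * flux1 m w p + c * flux2 m w p)
      = 2 * m / τ * norm2 (u p - w p) := by
  have hflux : ∀ h : ℝ × ℝ → Fin 2 → ℂ, -s * flux1 m h p + c * flux2 m h p
      = current h (c, s) p
        - 2 * m * (c * ((h p 0).re * (h p 1).re + (h p 0).im * (h p 1).im)
          + s * ((h p 0).re * (h p 1).im - (h p 0).im * (h p 1).re)) := by
    intro h
    have : fderiv ℝ h p (c, s) = c • fderiv ℝ h p (1, 0) + s • fderiv ℝ h p (0, 1) := by
      rw [← map_smul, ← map_smul, ← map_add]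
      simp
    simp only [flux1, flux2, current, this, Pi.add_apply, Pi.smul_apply, Complex.add_re,
      Complex.add_im, Complex.smul_re, Complex.smul_im, smul_eq_mul]
    ring
  rw [hflux, hflux]
  simp only [current, h0, h1]
  generalize u p = X
  generalize fderiv ℝ u p (c, s) = Y
  simp only [norm2, edgeMatrix, Complex.normSq_apply, Matrix.mulVec, dotProduct,
    Fin.sum_univ_two, Pi.sub_apply, Matrix.smul_apply, smul_eq_mul, Matrix.of_apply,
    Matrix.cons_val', Matrix.cons_val_zero, Matrix.cons_val_one, Matrix.cons_val_fin_one,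
    Complex.add_re, Complex.add_im, Complex.sub_re, Complex.sub_im, Complex.mul_re,
    Complex.mul_im, Complex.I_re, Complex.I_im, Complex.ofReal_re, Complex.ofReal_im]
  generalize (X 0).re = a1
  generalize (X 0).im = a2
  generalize (X 1).re = b1
  generalize (X 1).im = b2
  generalize (Y 0).re = a1'
  generalize (Y 0).im = a2'
  generalize (Y 1).re = b1'
  generalize (Y 1).im = b2'
  obtain ⟨K, hK⟩ : ∃ K, K = 1 / (1 - τ ^ 2 / 4) := ⟨_, rfl⟩
  obtain ⟨S, hS⟩ : ∃ S, S = 1 + τ ^ 2 / 4 := ⟨_, rfl⟩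
  rw [← hK, ← hS]
  have e : K * (1 - τ ^ 2 / 4) = 1 := by
    rw [hK, one_div, inv_mul_cancel₀ hD]
  have e0 : 1 - K * S = -K * τ ^ 2 / 2 := by
    rw [hS]
    linear_combination -e
  have e1 : K ^ 2 * (S ^ 2 - τ ^ 2) = 1 := by
    rw [hS]
    linear_combination (K * (1 - τ ^ 2 / 4) + 1) * e
  have e2 : τ * (K ^ 2 * (S ^ 2 + τ ^ 2) - 1) = 2 * (-2 * (1 - K * S) * K * τ) := by
    rw [e0]
    linear_combination τ * e1
  have e3 : τ * (K ^ 2 * (2 * S * τ)) = 2 * ((1 - K * S) ^ 2 + K ^ 2 * τ ^ 2) := by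
    rw [e0, hS]
    ring
  rw [div_mul_eq_mul_div, eq_div_iff hτ0]
  linear_combination
    -(τ * ((a1 * a2' - a2 * a1') - (b1 * b2' - b2 * b1'))) * e1
    + m * (2 * (c * (a1 * b1 + a2 * b2) + s * (a1 * b2 - a2 * b1))) * e2
    + m * (a1 * a1 + a2 * a2 + (b1 * b1 + b2 * b2)) * e3
    + (τ ^ 3 * K ^ 2 * ((a1 * a2' - a2 * a1') - (b1 * b2' - b2 * b1'))
      + m * τ ^ 3 * K ^ 2 * (2 * (c * (a1 * b1 + a2 * b2) + s * (a1 * b2 - a2 * b1)))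
      + 2 * m * K ^ 2 * τ ^ 2 * (S - 1) * (a1 * a1 + a2 * a2 + (b1 * b1 + b2 * b2))) * hcs

lemma setIntegral_norm2_edge {τ c s m : ℝ} (hτ0 : τ ≠ 0) (hD : 1 - τ ^ 2 / 4 ≠ 0)
    (hcs : c ^ 2 + s ^ 2 = 1) {u w : ℝ × ℝ → Fin 2 → ℂ}
    (hu : ContDiff ℝ 2 u) (hw : ContDiff ℝ 2 w)
    (huc : HasCompactSupport u) (hwc : HasCompactSupport w) {v : ℝ × ℝ}
    (hv : v = (c, s) ∨ v = -(c, s))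
    (h : ∀ r : ℝ, 0 < r → w (r • v) = (edgeMatrix τ c s).mulVec (u (r • v))) :
    (∫ r in Set.Ioi (0 : ℝ), (-s * flux1 m u (r • v) + c * flux2 m u (r • v)))
      - (∫ r in Set.Ioi (0 : ℝ), (-s * flux1 m w (r • v) + c * flux2 m w (r • v)))
      = 2 * m / τ * ∫ r in Set.Ioi (0 : ℝ), norm2 (u (r • v) - w (r • v)) := by
  have hv0 : v ≠ 0 := by
    rintro rfl
    have h0 : ((c, s) : ℝ × ℝ) = 0 := by
      rcases hv with hv | hv
      · exact hv.symm
      · exact neg_eq_zero.1 hv.symm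
    obtain ⟨rfl, rfl⟩ := Prod.mk_eq_zero.1 h0
    norm_num at hcs
  have hemb : Topology.IsClosedEmbedding fun r : ℝ => r • v :=
    LinearMap.isClosedEmbedding_of_injective (f := LinearMap.toSpanSingleton ℝ (ℝ × ℝ) v)
      (LinearMap.ker_toSpanSingleton ℝ hv0)
  have hint : ∀ {k : ℝ × ℝ → Fin 2 → ℂ}, ContDiff ℝ 2 k → HasCompactSupport k →
      Integrable fun r : ℝ => -s * flux1 m k (r • v) + c * flux2 m k (r • v) := by
    intro k hk hkc
    have h1 : Integrable fun r : ℝ => flux1 m k (r • v) :=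
      ((contDiff_flux1 m hk).continuous.comp hemb.continuous).integrable_of_hasCompactSupport
        ((hasCompactSupport_flux1 m hkc).comp_isClosedEmbedding hemb)
    have h2 : Integrable fun r : ℝ => flux2 m k (r • v) :=
      ((contDiff_flux2 m hk).continuous.comp hemb.continuous).integrable_of_hasCompactSupport
        ((hasCompactSupport_flux2 m hkc).comp_isClosedEmbedding hemb)
    exact Integrable.fun_add (h1.const_mul _) (h2.const_mul _)
  rw [← integral_sub (hint hu huc).integrableOn (hint hw hwc).integrableOn, ← integral_const_mul]
  refine setIntegral_congr_fun measurableSet_Ioi fun r hr => ?_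
  refine flux_jump hτ0 hD hcs (h r hr) ?_
  have hd := fderiv_ray_eq_mulVec (hu.differentiable two_ne_zero) (hw.differentiable two_ne_zero)
    h hr
  rcases hv with hv | hv
  · rwa [← hv]
  · rw [show ((c, s) : ℝ × ℝ) = -v by rw [hv, neg_neg], map_neg, map_neg, hd, Matrix.mulVec_neg]

/-- The quadratic form identity
`‖S_τu‖² = ‖∇u‖² + m²‖u‖² + (2m/τ)‖u₊|_Γ − u₋|_Γ‖²_Γ`
for the Dirac operator with Lorentz scalar δ-shell interaction on a broken line,
for smooth compactly supported data satisfying the transmission conditions. -/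
theorem quadratic_form_identity (ω m τ : ℝ)
    (hω : ω ∈ Set.Ioo 0 (Real.pi / 2)) (hm : 0 < m)
    (hτ : τ ≠ -2) (hτ0 : τ ≠ 0) (hτ' : τ ≠ 2)
    (up um : ℝ × ℝ → Fin 2 → ℂ)
    (hup : ContDiff ℝ (⊤ : ℕ∞) up) (hum : ContDiff ℝ (⊤ : ℕ∞) um)
    (hupc : HasCompactSupport up) (humc : HasCompactSupport um)
    (htl : ∀ r : ℝ, 0 < r →
      um (r * Real.cos ω, r * Real.sin ω)
        = (Ml ω τ).mulVec (up (r * Real.cos ω, r * Real.sin ω)))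
    (htr : ∀ r : ℝ, 0 < r →
      um (r * Real.cos ω, -(r * Real.sin ω))
        = (Mr ω τ).mulVec (up (r * Real.cos ω, -(r * Real.sin ω)))) :
    (∫ p in wedge ω, norm2 (diracOp m up p))
        + (∫ p in (closure (wedge ω))ᶜ, norm2 (diracOp m um p))
      = (∫ p in wedge ω, (norm2 (pd1 up p) + norm2 (pd2 up p)))
          + (∫ p in (closure (wedge ω))ᶜ, (norm2 (pd1 um p) + norm2 (pd2 um p)))
          + m ^ 2 * ((∫ p in wedge ω, norm2 (up p))
              + (∫ p in (closure (wedge ω))ᶜ, norm2 (um p)))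
          + (2 * m / τ) *
            ((∫ r in Set.Ioi (0 : ℝ),
                norm2 (up (r * Real.cos ω, r * Real.sin ω)
                  - um (r * Real.cos ω, r * Real.sin ω)))
              + (∫ r in Set.Ioi (0 : ℝ),
                  norm2 (up (r * Real.cos ω, -(r * Real.sin ω))
                    - um (r * Real.cos ω, -(r * Real.sin ω))))) := by
  have hD : 1 - τ ^ 2 / 4 ≠ 0 := by
    intro h0
    have : (τ - 2) * (τ + 2) = 0 := by linear_combination -4 * h0
    rcases mul_eq_zero.1 this with h1 | h1
    · exact hτ' (by linarith)
    · exact hτ (by linarith)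
  have hu : ContDiff ℝ 2 up := contDiff_infty.1 hup 2
  have hw : ContDiff ℝ 2 um := contDiff_infty.1 hum 2
  have hl := setIntegral_norm2_edge (m := m) (c := cos ω) (s := sin ω) hτ0 hD
    (by rw [add_comm, sin_sq_add_cos_sq]) hu hw hupc humc (v := (cos ω, sin ω)) (Or.inl rfl)
    (by simpa [Ml_eq_edgeMatrix] using htl)
  have hr := setIntegral_norm2_edge (m := m) (c := -cos ω) (s := sin ω) hτ0 hD
    (by rw [neg_sq, add_comm, sin_sq_add_cos_sq]) hu hw hupc humc (v := (cos ω, -sin ω))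
    (Or.inr (by simp)) (by simpa [Mr_eq_edgeMatrix] using htr)
  simp only [Prod.smul_mk, smul_eq_mul, mul_neg, neg_mul (cos ω), ← sub_eq_add_neg] at hl hr
  have hdu := setIntegral_wedge_div hω (contDiff_flux1 m hu) (hasCompactSupport_flux1 m hupc)
    (contDiff_flux2 m hu) (hasCompactSupport_flux2 m hupc)
  have hdw := setIntegral_wedge_div hω (contDiff_flux1 m hw) (hasCompactSupport_flux1 m humc)
    (contDiff_flux2 m hw) (hasCompactSupport_flux2 m humc)
  rw [setIntegral_norm2_diracOp hu hupc, setIntegral_norm2_diracOp hw humc,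
    setIntegral_wedge_compl_div (contDiff_flux1 m hw) (hasCompactSupport_flux1 m humc)
    (contDiff_flux2 m hw) (hasCompactSupport_flux2 m humc)]
  linear_combination hdu - hdw + hl + hr

end
end

section
/- Let m > 0, τ < 0 with τ ≠ −2, and γ > 0. Let k_γ be the unique positive solution of k·tanh(γk) = −4mτ/(4+τ²), and set E(γ) := m² − k_γ². Let M̃ := ((4+τ²)/(4−τ²))·σ₀ − (4τ/(4−τ²))·σ₃. Then for all continuously differentiable functions f₊ : [0,γ] → ℂ² and f₋ : [−γ,0] → ℂ² satisfying the transmission condition f₋(0) = M̃·f₊(0), one has ∫₀^γ |f₊'(y)|² dy + ∫_{−γ}^0 |f₋'(y)|² dy + m²·(∫₀^γ |f₊(y)|² dy + ∫_{−γ}^0 |f₋(y)|² dy) + (2m/τ)·|f₊(0) − f₋(0)|² ≥ E(γ)·(∫₀^γ |f₊(y)|² dy + ∫_{−γ}^0 |f₋(y)|² dy). -/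
open Matrix MeasureTheory

noncomputable section

/-- The diagonalized transmission matrix `M̃ = ((4+τ²)/(4−τ²))·σ₀ − (4τ/(4−τ²))·σ₃`. -/
def Mtilde (τ : ℝ) : Matrix (Fin 2) (Fin 2) ℂ :=
  (((4 + τ ^ 2) / (4 - τ ^ 2) : ℝ) : ℂ) • (1 : Matrix (Fin 2) (Fin 2) ℂ)
    - (((4 * τ) / (4 - τ ^ 2) : ℝ) : ℂ) • σ3

theorem hasDerivAt_tanh (x : ℝ) : HasDerivAt Real.tanh (1 - Real.tanh x ^ 2) x := by
  have h := (Real.hasDerivAt_sinh x).div (Real.hasDerivAt_cosh x) (Real.cosh_pos x).ne'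
  have hfun : Real.tanh = fun y => Real.sinh y / Real.cosh y :=
    funext Real.tanh_eq_sinh_div_cosh
  rw [hfun]
  refine h.congr_deriv ?_
  have := (Real.cosh_pos x).ne'
  field_simp

section TraceInequality

variable {E : Type*} [NormedAddCommGroup E] [InnerProductSpace ℝ E]

/-- Trace inequality at the left end of `[0, γ]`, with the optimal constant. -/
theorem tanh_mul_norm_sq_le_integral {f : ℝ → E} (hf : ContDiff ℝ 1 f) (k : ℝ) {γ : ℝ}
    (hγ : 0 ≤ γ) :
    k * Real.tanh (γ * k) * ‖f 0‖ ^ 2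
      ≤ (∫ y in (0 : ℝ)..γ, ‖deriv f y‖ ^ 2) + k ^ 2 * ∫ y in (0 : ℝ)..γ, ‖f y‖ ^ 2 := by
  have hf' : Continuous (deriv f) := hf.continuous_deriv le_rfl
  have hfc : Continuous f := hf.continuous
  have htanh : Continuous Real.tanh :=
    continuous_iff_continuousAt.2 fun x => (hasDerivAt_tanh x).continuousAt
  set w : ℝ → ℝ := fun y => k * Real.tanh ((γ - y) * k) with hw
  have hwc : Continuous w := by fun_prop
  have hwd : ∀ y, HasDerivAt w (w y ^ 2 - k ^ 2) y := by
    intro y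
    have h1 : HasDerivAt (fun y : ℝ => (γ - y) * k) (-1 * k) y :=
      ((hasDerivAt_id y).const_sub γ).mul_const k
    refine (((hasDerivAt_tanh _).comp y h1).const_mul k).congr_deriv ?_
    simp only [hw]
    ring
  have hd : ∀ y, HasDerivAt (fun y => -(w y * ‖f y‖ ^ 2))
      (-((w y ^ 2 - k ^ 2) * ‖f y‖ ^ 2 + w y * (2 * inner ℝ (f y) (deriv f y)))) y := fun y =>
    ((hwd y).mul ((hf.differentiable one_ne_zero y).hasDerivAt.norm_sq)).neg
  have hDc : Continuous fun y =>
      -((w y ^ 2 - k ^ 2) * ‖f y‖ ^ 2 + w y * (2 * inner ℝ (f y) (deriv f y))) := by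
    fun_prop
  have hint := intervalIntegral.integral_eq_sub_of_hasDerivAt (fun y _ => hd y)
    (hDc.intervalIntegrable 0 γ)
  have hc1 : Continuous fun y => ‖deriv f y‖ ^ 2 := by fun_prop
  have hc2 : Continuous fun y => k ^ 2 * ‖f y‖ ^ 2 := by fun_prop
  rw [← intervalIntegral.integral_const_mul,
    ← intervalIntegral.integral_add (hc1.intervalIntegrable _ _) (hc2.intervalIntegrable _ _)]
  calc k * Real.tanh (γ * k) * ‖f 0‖ ^ 2
      = ∫ y in (0 : ℝ)..γ,
          -((w y ^ 2 - k ^ 2) * ‖f y‖ ^ 2 + w y * (2 * inner ℝ (f y) (deriv f y))) := by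
        rw [hint]
        simp [hw]
    _ ≤ _ := by
        refine intervalIntegral.integral_mono_on hγ (hDc.intervalIntegrable _ _)
          ((hc1.add hc2).intervalIntegrable _ _) fun y _ => ?_
        have h := norm_add_sq_real (deriv f y) (w y • f y)
        rw [norm_smul, inner_smul_right, real_inner_comm, mul_pow, Real.norm_eq_abs, sq_abs] at h
        nlinarith [sq_nonneg ‖deriv f y + w y • f y‖]

/-- Trace inequality at the right end of `[-γ, 0]`, with the optimal constant. -/
theorem tanh_mul_norm_sq_le_integral_neg {f : ℝ → E} (hf : ContDiff ℝ 1 f) (k : ℝ) {γ : ℝ}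
    (hγ : 0 ≤ γ) :
    k * Real.tanh (γ * k) * ‖f 0‖ ^ 2
      ≤ (∫ y in (-γ)..0, ‖deriv f y‖ ^ 2) + k ^ 2 * ∫ y in (-γ)..0, ‖f y‖ ^ 2 := by
  have h := tanh_mul_norm_sq_le_integral (f := fun y => f (-y)) (hf.comp contDiff_neg) k hγ
  simp only [deriv_comp_neg, norm_neg, neg_zero] at h
  rwa [intervalIntegral.integral_comp_neg (fun y => ‖deriv f y‖ ^ 2),
    intervalIntegral.integral_comp_neg (fun y => ‖f y‖ ^ 2), neg_zero] at h

end TraceInequality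

theorem norm2_eq (v : Fin 2 → ℂ) : norm2 v = ‖v 0‖ ^ 2 + ‖v 1‖ ^ 2 := by
  simp [norm2, Complex.normSq_eq_norm_sq]

theorem setIntegral_norm2 {f : ℝ → Fin 2 → ℂ} (hf : Continuous f) {a b : ℝ} (hab : a ≤ b) :
    ∫ y in Set.Ioc a b, norm2 (f y)
      = (∫ y in a..b, ‖f y 0‖ ^ 2) + ∫ y in a..b, ‖f y 1‖ ^ 2 := by
  have h (i : Fin 2) : Continuous fun y => ‖f y i‖ ^ 2 := by fun_prop
  rw [← intervalIntegral.integral_of_le hab,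
    ← intervalIntegral.integral_add ((h 0).intervalIntegrable _ _) ((h 1).intervalIntegrable _ _)]
  simp only [norm2_eq]

theorem setIntegral_norm2_deriv {f : ℝ → Fin 2 → ℂ} (hf : ContDiff ℝ 1 f) {a b : ℝ}
    (hab : a ≤ b) :
    ∫ y in Set.Ioc a b, norm2 (deriv f y)
      = (∫ y in a..b, ‖deriv (fun x => f x 0) y‖ ^ 2)
        + ∫ y in a..b, ‖deriv (fun x => f x 1) y‖ ^ 2 := by
  have h (i : Fin 2) (y : ℝ) : deriv (fun x => f x i) y = deriv f y i :=
    (hasDerivAt_pi.1 (hf.differentiable one_ne_zero y).hasDerivAt i).deriv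
  simp only [setIntegral_norm2 (hf.continuous_deriv le_rfl) hab, h]

/-- The boundary terms cancel exactly under the transmission condition. -/
theorem transmission_boundary_identity {m τ : ℝ} (hτ : τ < 0) (hτ' : τ ≠ -2) (v : Fin 2 → ℂ) :
    -4 * m * τ / (4 + τ ^ 2) * (norm2 v + norm2 ((Mtilde τ).mulVec v))
      + 2 * m / τ * norm2 (v - (Mtilde τ).mulVec v) = 0 := by
  have h1 : 2 + τ ≠ 0 := fun h => hτ' (by linarith)
  have h2 : 2 - τ ≠ 0 := by linarith
  have h3 : 4 - τ ^ 2 = (2 - τ) * (2 + τ) := by ring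
  have h4 : 4 + τ ^ 2 ≠ 0 := by positivity
  have hτ0 : τ ≠ 0 := hτ.ne
  have e0 : (Mtilde τ).mulVec v 0 = (((2 - τ) / (2 + τ) : ℝ) : ℂ) * v 0 := by
    have : (2 - τ) / (2 + τ) = (4 + τ ^ 2) / (4 - τ ^ 2) - 4 * τ / (4 - τ ^ 2) := by
      rw [h3]; field_simp; ring
    rw [this]
    simp [Mtilde, σ3, Matrix.mulVec, dotProduct, Fin.sum_univ_two]
  have e1 : (Mtilde τ).mulVec v 1 = (((2 + τ) / (2 - τ) : ℝ) : ℂ) * v 1 := by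
    have : (2 + τ) / (2 - τ) = (4 + τ ^ 2) / (4 - τ ^ 2) + 4 * τ / (4 - τ ^ 2) := by
      rw [h3]; field_simp; ring
    rw [this]
    simp [Mtilde, σ3, Matrix.mulVec, dotProduct, Fin.sum_univ_two]
  have hsub (a : ℝ) (z : ℂ) : Complex.normSq (z - a * z) = (1 - a) ^ 2 * Complex.normSq z := by
    rw [show z - a * z = ((1 - a : ℝ) : ℂ) * z by push_cast; ring, Complex.normSq_mul,
      Complex.normSq_ofReal, sq]
  simp only [norm2, Pi.sub_apply, e0, e1, hsub, Complex.normSq_mul, Complex.normSq_ofReal]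
  field_simp
  ring

/-- Lower bound for the one-dimensional auxiliary quadratic form with a δ-type transmission
condition: the form is bounded below by `E(γ) = m² − k_γ²`, where `k_γ` is the unique positive
solution of `k·tanh(γk) = −4mτ/(4+τ²)`. -/
theorem auxiliary_form_lower_bound (m τ γ : ℝ)
    (hm : 0 < m) (hτ : τ < 0) (hτ' : τ ≠ -2) (hγ : 0 < γ)
    (kγ : ℝ) (hkγ : 0 < kγ)
    (hk : kγ * Real.tanh (γ * kγ) = -4 * m * τ / (4 + τ ^ 2))
    (fp fm : ℝ → Fin 2 → ℂ)
    (hfp : ContDiff ℝ 1 fp) (hfm : ContDiff ℝ 1 fm)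
    (htrans : fm 0 = (Mtilde τ).mulVec (fp 0)) :
    (m ^ 2 - kγ ^ 2) *
        ((∫ y in Set.Ioc (0 : ℝ) γ, norm2 (fp y))
          + (∫ y in Set.Ioc (-γ) (0 : ℝ), norm2 (fm y)))
      ≤ (∫ y in Set.Ioc (0 : ℝ) γ, norm2 (deriv fp y))
          + (∫ y in Set.Ioc (-γ) (0 : ℝ), norm2 (deriv fm y))
          + m ^ 2 * ((∫ y in Set.Ioc (0 : ℝ) γ, norm2 (fp y))
              + (∫ y in Set.Ioc (-γ) (0 : ℝ), norm2 (fm y)))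
          + (2 * m / τ) * norm2 (fp 0 - fm 0) := by
  have hcomp {f : ℝ → Fin 2 → ℂ} (hf : ContDiff ℝ 1 f) (i : Fin 2) :
      ContDiff ℝ 1 fun y => f y i := contDiff_pi.1 hf i
  have hp (i : Fin 2) := tanh_mul_norm_sq_le_integral (hcomp hfp i) kγ hγ.le
  have hn (i : Fin 2) := tanh_mul_norm_sq_le_integral_neg (hcomp hfm i) kγ hγ.le
  have hb := transmission_boundary_identity (m := m) hτ hτ' (fp 0)
  rw [← htrans, ← hk, norm2_eq (fp 0), norm2_eq (fm 0)] at hb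
  have hγ' : -γ ≤ 0 := by linarith
  rw [setIntegral_norm2 hfp.continuous hγ.le, setIntegral_norm2 hfm.continuous hγ',
    setIntegral_norm2_deriv hfp hγ.le, setIntegral_norm2_deriv hfm hγ']
  linarith [hp 0, hp 1, hn 0, hn 1]

end
end

section
/- Let f : ℝ → ℂ be a measurable function, and define g : ℝ → ℂ by g(x) := f(x) for x > 0 and g(x) := 0 for x ≤ 0. Then ∫₀^∞ |f(x)|²/x dx ≤ ∫_ℝ ∫_ℝ |g(x) − g(y)|²/(x − y)² dy dx, where both sides are interpreted as (possibly infinite) integrals with values in [0,∞]. -/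
open MeasureTheory

theorem lintegral_Ioi_inv_sq {x : ℝ} (hx : 0 < x) :
    ∫⁻ t in Set.Ioi x, (ENNReal.ofReal (t ^ 2))⁻¹ = (ENNReal.ofReal x)⁻¹ := by
  have hlt : (-2 : ℝ) < -1 := by norm_num
  have h := ofReal_integral_eq_lintegral_ofReal (integrableOn_Ioi_rpow_of_lt hlt hx)
    ((ae_restrict_mem measurableSet_Ioi).mono fun t ht =>
      Real.rpow_nonneg (hx.trans ht).le (-2 : ℝ))
  rw [integral_Ioi_rpow_of_lt hlt hx] at h
  have hx' : -x ^ ((-2 : ℝ) + 1) / (-2 + 1) = x⁻¹ := by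
    norm_num [Real.rpow_neg_one]
  rw [← ENNReal.ofReal_inv_of_pos hx, ← hx', h]
  refine setLIntegral_congr_fun measurableSet_Ioi fun t ht => ?_
  have ht0 : 0 < t := hx.trans ht
  rw [← ENNReal.ofReal_inv_of_pos (by positivity), Real.rpow_neg ht0.le, Real.rpow_two]

/-- The Hardy-type inequality for the half-line truncation: if `g` is the truncation of `f` to
`(0,∞)`, then `∫₀^∞ |f(x)|²/x dx` is bounded by the squared Gagliardo seminorm of order `1/2`
of `g`. -/
theorem truncation_hardy_inequality (f : ℝ → ℂ) (hf : Measurable f)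
    (g : ℝ → ℂ) (hg : ∀ x : ℝ, g x = if 0 < x then f x else 0) :
    (∫⁻ x in Set.Ioi (0 : ℝ), ENNReal.ofReal (‖f x‖ ^ 2) / ENNReal.ofReal x)
      ≤ ∫⁻ x : ℝ, ∫⁻ y : ℝ,
          ENNReal.ofReal (‖g x - g y‖ ^ 2) / ENNReal.ofReal ((x - y) ^ 2) := by
  refine (setLIntegral_mono' measurableSet_Ioi fun x hx => ?_).trans
    (setLIntegral_le_lintegral (Set.Ioi 0) _)
  rw [Set.mem_Ioi] at hx
  set F : ℝ → ENNReal := (Set.Ioi x).indicator fun t =>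
    ENNReal.ofReal (‖f x‖ ^ 2) * (ENNReal.ofReal (t ^ 2))⁻¹ with hF
  calc ENNReal.ofReal (‖f x‖ ^ 2) / ENNReal.ofReal x
      = ∫⁻ t, F t := by
        rw [hF, lintegral_indicator measurableSet_Ioi, lintegral_const_mul _ (by fun_prop),
          lintegral_Ioi_inv_sq hx, div_eq_mul_inv]
    _ = ∫⁻ y, F (x - y) := (lintegral_sub_left_eq_self F x).symm
    _ ≤ _ := by
        refine lintegral_mono fun y => Set.indicator_apply_le' (fun hy => ?_) fun _ => zero_le
        have hy0 : ¬ 0 < y := by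
          rw [Set.mem_Ioi] at hy
          linarith
        rw [hg x, hg y, if_pos hx, if_neg hy0, sub_zero, div_eq_mul_inv]
end
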